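/- For every positive integer s, there is no ternary LCD [4s+3, 2, 3s+2] code; that is, there is no 2-dimensional linear subspace C of 𝔽_3^{4s+3} with C ∩ C⊥ = {0} whose minimum weight is 3s+2. -/

import Mathlib

open Matrix Finset

/-- The (Hamming) weight of a vector. -/
def wt {R : Type*} [Zero R] [DecidableEq R] {n : ℕ} (x : Fin n → R) : ℕ :=
  (Finset.univ.filter fun i => x i ≠ 0).card

/-- The dual code of a linear code, w.r.t. the standard inner product. -/
def dualCode {R : Type*} [CommRing R] {n : ℕ} (C : Submodule R (Fin n → R)) :
    Submodule R (Fin n → R) where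
  carrier := {x | ∀ y ∈ C, ∑ i, x i * y i = 0}
  add_mem' := by
    intro a b ha hb y hy
    have ha' := ha y hy
    have hb' := hb y hy
    simp only [Set.mem_setOf_eq, Pi.add_apply, add_mul, Finset.sum_add_distrib, ha', hb',
      add_zero]
  zero_mem' := by intro y hy; simp
  smul_mem' := by
    intro c x hx y hy
    have h := hx y hy
    simp only [Set.mem_setOf_eq, Pi.smul_apply, smul_eq_mul, mul_assoc, ← Finset.mul_sum, h,
      mul_zero]

/-- A linear code is LCD if it intersects its dual trivially. -/
def IsLCD {R : Type*} [CommRing R] {n : ℕ} (C : Submodule R (Fin n → R)) : Prop :=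
  C ⊓ dualCode C = ⊥

/-- `C` has minimum weight `d`. -/
def HasMinWeight {R : Type*} [CommRing R] [DecidableEq R] {n : ℕ}
    (C : Submodule R (Fin n → R)) (d : ℕ) : Prop :=
  (∃ x ∈ C, x ≠ 0 ∧ wt x = d) ∧ ∀ x ∈ C, x ≠ 0 → d ≤ wt x

/-- The dual distance of `C` is at least `d`. -/
def DualDistGe {R : Type*} [CommRing R] [DecidableEq R] {n : ℕ}
    (C : Submodule R (Fin n → R)) (d : ℕ) : Prop :=
  ∀ x ∈ dualCode C, x ≠ 0 → d ≤ wt x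

/-- A monomial matrix: exactly one nonzero entry in each row and column. -/
def IsMonomial {R : Type*} [CommRing R] {n : ℕ} (P : Matrix (Fin n) (Fin n) R) : Prop :=
  ∃ (σ : Equiv.Perm (Fin n)) (c : Fin n → R), (∀ i, c i ≠ 0) ∧
    ∀ i j, P i j = if σ i = j then c i else 0

/-- Two codes of the same length are equivalent if one is the image of the other
under (right) multiplication by a monomial matrix. -/
def codeEquiv {R : Type*} [CommRing R] {n : ℕ} (C₁ C₂ : Submodule R (Fin n → R)) : Prop :=
  ∃ P : Matrix (Fin n) (Fin n) R, IsMonomial P ∧ C₂ = C₁.map (Matrix.vecMulLinear P)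

/-- `G` is a generator matrix of `C`: the rows of `G` form a basis of `C`. -/
def IsGenMatrix {R : Type*} [CommRing R] {k n : ℕ} (C : Submodule R (Fin n → R))
    (G : Matrix (Fin k) (Fin n) R) : Prop :=
  LinearIndependent R (fun i : Fin k => G i) ∧
    Submodule.span R (Set.range fun i : Fin k => G i) = C

/-- The code generated by the rows of a matrix. -/
def rowSpace {R : Type*} [CommRing R] {k n : ℕ} (G : Matrix (Fin k) (Fin n) R) :
    Submodule R (Fin n → R) :=
  Submodule.span R (Set.range fun i : Fin k => G i)

/-- `[k]_q = (q^k - 1)/(q - 1) = 1 + q + ⋯ + q^(k-1)`. -/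
def qrep (q k : ℕ) : ℕ := ∑ i ∈ Finset.range k, q ^ i

/-- The columns of the simplex-code generator matrix `S_{q,k}`, defined inductively. -/
def simplexCol (q : ℕ) : (k : ℕ) → ℕ → (Fin k → ZMod q)
  | 0, _ => fun i => i.elim0
  | (k+1), j =>
    if j < qrep q k then Fin.snoc (simplexCol q k j) 0
    else if j = qrep q k then Fin.snoc (fun _ => 0) 1
    else Fin.snoc (simplexCol q k ((j - qrep q k - 1) % qrep q k))
      (((j - qrep q k - 1) / qrep q k + 1 : ℕ) : ZMod q)

/-- The generator matrix `S_{q,k}` of the simplex code. -/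
def simplexMatrix (q k : ℕ) : Matrix (Fin k) (Fin (qrep q k)) (ZMod q) :=
  Matrix.of fun i j => simplexCol q k (j : ℕ) i

/-- Juxtaposition `(A | B)` of two matrices. -/
def hcat {R : Type*} {k a b : ℕ} (A : Matrix (Fin k) (Fin a) R) (B : Matrix (Fin k) (Fin b) R) :
    Matrix (Fin k) (Fin (a + b)) R :=
  Matrix.of fun i j =>
    if h : (j : ℕ) < a then A i ⟨j, h⟩ else B i ⟨(j : ℕ) - a, by have := j.isLt; omega⟩

/-- `A^{(s)}`: juxtaposition of `s` copies of `A`. -/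
def reps {R : Type*} {k r : ℕ} (A : Matrix (Fin k) (Fin r) R) (s : ℕ) :
    Matrix (Fin k) (Fin (r * s)) R :=
  Matrix.of fun i j => A i ⟨(j : ℕ) % r,
    Nat.mod_lt _ (Nat.pos_of_ne_zero fun hr => by subst hr; simpa using j.isLt)⟩

/-- The list of columns of `G_{q,k}(m)`: `m i` copies of the `i`-th column of `S_{q,k}`. -/
def colList (q k : ℕ) (m : Fin (qrep q k) → ℕ) : List (Fin k → ZMod q) :=
  (List.finRange (qrep q k)).flatMap fun i => List.replicate (m i) (simplexCol q k (i : ℕ))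

lemma colList_length (q k : ℕ) (m : Fin (qrep q k) → ℕ) :
    (colList q k m).length = ∑ i, m i := by
  simp [colList, List.length_flatMap, Function.comp_def]
  rw [← List.ofFn_eq_map, List.sum_ofFn]

/-- The matrix `G_{q,k}(m)`, consisting of `m i` copies of the `i`-th column of `S_{q,k}`. -/
def Gqk (q k : ℕ) (m : Fin (qrep q k) → ℕ) : Matrix (Fin k) (Fin (∑ i, m i)) (ZMod q) :=
  Matrix.of fun i j => (colList q k m).get (Fin.cast (colList_length q k m).symm j) i

theorem ternary_sum_mul_self_eq_wt {n : ℕ} (x : Fin n → ZMod 3) :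
    ∑ i, x i * x i = (wt x : ZMod 3) := by
  have key : ∀ a : ZMod 3, a * a = if a ≠ 0 then 1 else 0 := by decide
  simp only [wt, key, Finset.sum_boole]

/-- The four points of a pencil in a ternary code have total weight at most `3 n`. -/
theorem ternary_wt_pencil_le {n : ℕ} (x y : Fin n → ZMod 3) :
    wt x + wt y + wt (x + y) + wt (x - y) ≤ 3 * n := by
  have key : ∀ a b : ZMod 3, (if a ≠ 0 then 1 else 0) + (if b ≠ 0 then 1 else 0) +
      (if a + b ≠ 0 then 1 else 0) + (if a - b ≠ 0 then 1 else 0) ≤ 3 := by decide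
  simp only [wt, Finset.card_filter, ← Finset.sum_add_distrib, Pi.add_apply, Pi.sub_apply]
  refine (Finset.sum_le_sum fun i _ => key (x i) (y i)).trans ?_
  simp [mul_comm]

theorem IsLCD.eq_zero {R : Type*} [CommRing R] {n : ℕ} {C : Submodule R (Fin n → R)}
    (hC : IsLCD C) {u : Fin n → R} (hu : u ∈ C) (h : ∀ z ∈ C, u ⬝ᵥ z = 0) : u = 0 := by
  have : u ∈ C ⊓ dualCode C := ⟨hu, h⟩
  rwa [hC, Submodule.mem_bot] at this

/-- For every positive integer `s`, there is no ternary LCD `[4s+3, 2, 3s+2]` code. -/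
theorem no_ternary_lcd_4s3 (s : ℕ) (hs : 1 ≤ s) :
    ¬ ∃ C : Submodule (ZMod 3) (Fin (4 * s + 3) → ZMod 3),
      Module.finrank (ZMod 3) C = 2 ∧ IsLCD C ∧ HasMinWeight C (3 * s + 2) := by
  rintro ⟨C, hdim, hlcd, -, hmin⟩
  let b := Module.finBasisOfFinrankEq (ZMod 3) C hdim
  obtain ⟨x, hx⟩ : ∃ x : Fin (4 * s + 3) → ZMod 3, x = b 0 := ⟨_, rfl⟩
  obtain ⟨y, hy⟩ : ∃ y : Fin (4 * s + 3) → ZMod 3, y = b 1 := ⟨_, rfl⟩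
  have hxC : x ∈ C := hx ▸ (b 0).2
  have hyC : y ∈ C := hy ▸ (b 1).2
  have hspan : ∀ z ∈ C, ∃ p q : ZMod 3, z = p • x + q • y := by
    intro z hz
    refine ⟨b.repr ⟨z, hz⟩ 0, b.repr ⟨z, hz⟩ 1, ?_⟩
    have h := congrArg Subtype.val (b.sum_repr ⟨z, hz⟩)
    rw [Fin.sum_univ_two] at h
    rw [hx, hy]
    exact h.symm
  have hind : ∀ p q : ZMod 3, p • x + q • y = 0 → p = 0 ∧ q = 0 := by
    intro p q h
    have hli := LinearIndependent.pair_iff.1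
      (show LinearIndependent (ZMod 3) ![b 0, b 1] by
        convert b.linearIndependent using 1
        ext i : 1
        fin_cases i <;> rfl)
    refine hli p q (Subtype.ext ?_)
    rw [hx, hy] at h
    exact h
  have hne : ∀ p q : ZMod 3, ¬ (p = 0 ∧ q = 0) → 3 * s + 2 ≤ wt (p • x + q • y) := fun p q h =>
    hmin _ (C.add_mem (C.smul_mem _ hxC) (C.smul_mem _ hyC)) fun h0 => h (hind p q h0)
  have hrad : ∀ p q : ZMod 3, p * (x ⬝ᵥ x) + q * (x ⬝ᵥ y) = 0 →
      p * (x ⬝ᵥ y) + q * (y ⬝ᵥ y) = 0 → p = 0 ∧ q = 0 := by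
    intro p q h1 h2
    refine hind p q (hlcd.eq_zero (C.add_mem (C.smul_mem _ hxC) (C.smul_mem _ hyC)) ?_)
    intro z hz
    obtain ⟨p', q', rfl⟩ := hspan z hz
    simp only [add_dotProduct, dotProduct_add, smul_dotProduct, dotProduct_smul, smul_eq_mul]
    rw [dotProduct_comm y x]
    linear_combination p' * h1 + q' * h2
  have w1 : 3 * s + 2 ≤ wt x := by simpa using hne 1 0 (by decide)
  have w2 : 3 * s + 2 ≤ wt y := by simpa using hne 0 1 (by decide)
  have w3 : 3 * s + 2 ≤ wt (x + y) := by simpa using hne 1 1 (by decide)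
  have w4 : 3 * s + 2 ≤ wt (x - y) := by
    simpa [sub_eq_add_neg] using hne 1 (-1) (by decide)
  have hle := ternary_wt_pencil_le x y
  have g1 : x ⬝ᵥ x = (wt x : ZMod 3) := ternary_sum_mul_self_eq_wt x
  have g2 : y ⬝ᵥ y = (wt y : ZMod 3) := ternary_sum_mul_self_eq_wt y
  have g3 : (x + y) ⬝ᵥ (x + y) = (wt (x + y) : ZMod 3) := ternary_sum_mul_self_eq_wt _
  have g4 : (x - y) ⬝ᵥ (x - y) = (wt (x - y) : ZMod 3) := ternary_sum_mul_self_eq_wt _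
  simp only [add_dotProduct, dotProduct_add, sub_dotProduct, dotProduct_sub,
    dotProduct_comm y x] at g3 g4
  -- The excess weights `e i` over `3 s + 2` add up to at most one.
  obtain ⟨e1, h1⟩ := Nat.exists_eq_add_of_le w1
  obtain ⟨e2, h2⟩ := Nat.exists_eq_add_of_le w2
  obtain ⟨e3, h3⟩ := Nat.exists_eq_add_of_le w3
  obtain ⟨e4, h4⟩ := Nat.exists_eq_add_of_le w4
  have hcast : ∀ e : ℕ, ((3 * s + 2 + e : ℕ) : ZMod 3) = 2 + e := by
    intro e
    have h30 : (3 : ZMod 3) = 0 := rfl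
    push_cast
    rw [h30, zero_mul, zero_add]
  rw [h1, hcast] at g1
  rw [h2, hcast] at g2
  rw [h3, hcast] at g3
  rw [h4, hcast] at g4
  have hsum : e1 + e2 + e3 + e4 ≤ 1 := by omega
  clear h1 h2 h3 h4 w1 w2 w3 w4 hle hne
  generalize x ⬝ᵥ x = a at *
  generalize x ⬝ᵥ y = c at *
  generalize y ⬝ᵥ y = d at *
  have hdet : a * d ≠ c * c := by
    intro h
    obtain ⟨hd, hc⟩ := hrad d (-c) (by linear_combination h) (by ring)
    rw [neg_eq_zero] at hc
    exact one_ne_zero (hrad 0 1 (by simp [hc]) (by simp [hd])).2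
  have l1 : e1 ≤ 1 := by omega
  have l2 : e2 ≤ 1 := by omega
  have l3 : e3 ≤ 1 := by omega
  have l4 : e4 ≤ 1 := by omega
  interval_cases e1 <;> interval_cases e2 <;> interval_cases e3 <;> interval_cases e4 <;>
    first
    | omega
    | clear hsum l1 l2 l3 l4 hrad
      simp only [Nat.cast_zero, Nat.cast_one] at g1 g2 g3 g4
      revert a c d
      decide
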